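/- arXiv:1602.02560 — 2 statements merged into one kernel-verified Lean document; each statement's English description precedes it below -/
import Mathlib

section
/- Let A be a finite-dimensional real inner product space and let H be a group of linear automorphisms of A. Assume that for every compact subset Ω of A ∖ {0} there exists a sequence (hₙ)ₙ∈ℕ in H such that the sets hₙ*(Ω) (images of Ω under the adjoint maps hₙ*) are pairwise disjoint. Then every continuous positive definite function Γ : A → ℂ satisfying Γ(h x) = Γ(x) for all h ∈ H and all x ∈ A is constant. -/
open scoped ComplexOrder

/-- A function `Γ : E → ℂ` is positive definite if for all finite families of points and
complex coefficients, `∑ᵢⱼ cᵢ c̄ⱼ Γ(xᵢ - xⱼ)` is a nonnegative real number. -/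
def IsPosDefFn {E : Type*} [AddCommGroup E] (Γ : E → ℂ) : Prop :=
  ∀ (n : ℕ) (x : Fin n → E) (c : Fin n → ℂ),
    0 ≤ ∑ i, ∑ j, c i * (starRingEnd ℂ) (c j) * Γ (x i - x j)

open MeasureTheory ProbabilityTheory Filter Complex
open scoped Topology FourierTransform RealInnerProductSpace

lemma IsPosDefFn.zero_nonneg {E : Type*} [AddCommGroup E] {Γ : E → ℂ} (h : IsPosDefFn Γ) :
    0 ≤ Γ 0 := by
  simpa using h 1 (fun _ => 0) (fun _ => 1)

lemma IsPosDefFn.two {E : Type*} [AddCommGroup E] {Γ : E → ℂ} (h : IsPosDefFn Γ) (x : E)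
    (a b : ℂ) : 0 ≤ a * (starRingEnd ℂ) a * Γ 0 + a * (starRingEnd ℂ) b * Γ x +
      (b * (starRingEnd ℂ) a * Γ (-x) + b * (starRingEnd ℂ) b * Γ 0) := by
  simpa [Fin.sum_univ_two] using h 2 ![x, 0] ![a, b]

lemma IsPosDefFn.neg {E : Type*} [AddCommGroup E] {Γ : E → ℂ} (h : IsPosDefFn Γ) (x : E) :
    Γ (-x) = (starRingEnd ℂ) (Γ x) := by
  have h0 := (Complex.nonneg_iff.1 h.zero_nonneg).2
  have h1 := (Complex.nonneg_iff.1 (h.two x 1 1)).2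
  have h2 := (Complex.nonneg_iff.1 (h.two x I 1)).2
  simp at h1 h2
  apply Complex.ext <;> simp <;> linarith

lemma IsPosDefFn.bound {E : Type*} [AddCommGroup E] {Γ : E → ℂ} (h : IsPosDefFn Γ) (x : E) :
    ‖Γ x‖ ≤ (Γ 0).re := by
  have h0 := (Complex.nonneg_iff.1 h.zero_nonneg)
  by_cases hx : Γ x = 0
  · simpa [hx] using h0.1
  have hp : 0 < ‖Γ x‖ := norm_pos_iff.2 hx
  have h1 := h.two x (-(starRingEnd ℂ) (Γ x)) (‖Γ x‖ : ℂ)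
  rw [h.neg] at h1
  have e : -(starRingEnd ℂ) (Γ x) * (starRingEnd ℂ) (-(starRingEnd ℂ) (Γ x)) * Γ 0 +
      -(starRingEnd ℂ) (Γ x) * (starRingEnd ℂ) (‖Γ x‖ : ℂ) * Γ x +
      (‖Γ x‖ * (starRingEnd ℂ) (-(starRingEnd ℂ) (Γ x)) * (starRingEnd ℂ) (Γ x) +
        ‖Γ x‖ * (starRingEnd ℂ) (‖Γ x‖ : ℂ) * Γ 0)
      = ((2 * ‖Γ x‖ ^ 2 * ((Γ 0).re - ‖Γ x‖) : ℝ) : ℂ) := by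
    have e0 : Γ 0 = ((Γ 0).re : ℂ) := by
      apply Complex.ext <;> simp [h0.2.symm]
    have e1 : Γ x * (starRingEnd ℂ) (Γ x) = (‖Γ x‖ : ℂ) ^ 2 := by
      rw [Complex.mul_conj, Complex.normSq_eq_norm_sq]; push_cast; rfl
    rw [e0]
    simp only [map_neg, Complex.conj_conj, Complex.conj_ofReal, Complex.ofReal_re]
    push_cast
    linear_combination (((Γ 0).re : ℂ) - 2 * ‖Γ x‖) * e1
  rw [e] at h1
  have h2 : 0 ≤ 2 * ‖Γ x‖ ^ 2 * ((Γ 0).re - ‖Γ x‖) := by exact_mod_cast h1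
  have := nonneg_of_mul_nonneg_right h2 (by positivity)
  linarith

section
variable {A : Type*} [NormedAddCommGroup A] [InnerProductSpace ℝ A] [FiniteDimensional ℝ A]
  [MeasurableSpace A] [BorelSpace A]

lemma IsPosDefFn.mul_char {Γ : A → ℂ} (h : IsPosDefFn Γ) (t : A) :
    IsPosDefFn (fun u => Γ u * cexp (⟪u, t⟫ * I)) := by
  intro n x c
  refine (h n x (fun i => c i * cexp (⟪x i, t⟫ * I))).trans_eq
    (Finset.sum_congr rfl fun i _ => Finset.sum_congr rfl fun j _ => ?_)
  rw [map_mul, ← Complex.exp_conj]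
  simp only [map_mul, Complex.conj_ofReal, Complex.conj_I, inner_sub_left]
  push_cast
  rw [sub_mul, Complex.exp_sub, mul_neg, Complex.exp_neg]
  ring

lemma IsPosDefFn.integral_prod {Γ : A → ℂ} (h : IsPosDefFn Γ) (hc : Continuous Γ)
    (P : Measure A) [IsProbabilityMeasure P] :
    0 ≤ ∫ p, Γ (p.1 - p.2) ∂(P.prod P) := by
  set J := ∫ p, Γ (p.1 - p.2) ∂(P.prod P) with hJ
  have key : ∀ n : ℕ, 0 ≤ (n : ℂ) * Γ 0 + (n : ℂ) * (n - 1) * J := by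
    intro n
    let Q : Measure (Fin n → A) := Measure.pi (fun _ => P)
    have hint : ∀ i j : Fin n, Integrable (fun x : Fin n → A => Γ (x i - x j)) Q := by
      intro i j
      refine Integrable.of_bound (C := (Γ 0).re) ?_ (ae_of_all _ fun x => h.bound _)
      exact (hc.measurable.comp (by fun_prop)).aestronglyMeasurable
    have e : ∫ x, (∑ i, ∑ j, Γ (x i - x j)) ∂Q = (n : ℂ) * Γ 0 + (n : ℂ) * (n - 1) * J := by
      rw [integral_finsetSum _ (fun i _ => integrable_finsetSum _ fun j _ => hint i j)]
      have : ∀ i j : Fin n, ∫ x, Γ (x i - x j) ∂Q = J + if i = j then Γ 0 - J else 0 := by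
        intro i j
        split_ifs with hij
        · subst hij; simp [Q]
        · have hind : IndepFun (fun x : Fin n → A => x i) (fun x => x j) Q :=
            (iIndepFun_pi (μ := fun _ : Fin n => P) (X := fun _ => id)
              (fun _ => aemeasurable_id)).indepFun hij
          rw [indepFun_iff_map_prod_eq_prod_map_map (measurable_pi_apply i).aemeasurable
            (measurable_pi_apply j).aemeasurable] at hind
          have m1 : ∀ k : Fin n, Q.map (fun x => x k) = P := fun k =>
            (measurePreserving_eval (fun _ : Fin n => P) k).map_eq
          rw [m1, m1] at hind
          rw [hJ, ← hind, integral_map (by fun_prop)]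
          · simp
          · exact (hc.measurable.comp (by fun_prop)).aestronglyMeasurable
      have : ∀ i : Fin n, ∫ x, ∑ j, Γ (x i - x j) ∂Q = n * J + (Γ 0 - J) := by
        intro i
        rw [integral_finsetSum _ (fun j _ => hint i j)]
        simp [this, Finset.sum_add_distrib]
      simp only [this]
      simp
      ring
    rw [← e]
    apply integral_nonneg
    intro x
    simpa using h n x (fun _ => 1)
  have g0 := Complex.nonneg_iff.1 h.zero_nonneg
  have k2 : ∀ n : ℕ, 0 ≤ (Γ 0).re + n * J.re ∧ 0 = n * J.im := by
    intro n
    have := key (n + 1)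
    have e : ((n + 1 : ℕ) : ℂ) * Γ 0 + ((n + 1 : ℕ) : ℂ) * ((n + 1 : ℕ) - 1) * J
      = ((n + 1 : ℝ) : ℂ) * (Γ 0 + n * J) := by push_cast; ring
    rw [e, Complex.nonneg_iff, Complex.re_ofReal_mul, Complex.im_ofReal_mul] at this
    have hn : (0 : ℝ) < n + 1 := by positivity
    have a := nonneg_of_mul_nonneg_right this.1 hn
    have b := (mul_eq_zero.1 this.2.symm).resolve_left hn.ne'
    simp [← g0.2] at a b ⊢
    exact ⟨a, b⟩
  rw [Complex.nonneg_iff]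
  constructor
  · by_contra! hneg
    obtain ⟨n, hn⟩ := exists_nat_gt ((Γ 0).re / (-J.re))
    rw [div_lt_iff₀ (by linarith)] at hn
    have := (k2 n).1
    linarith
  · simpa using (k2 1).2

/-- Normalised Gaussian measure. -/
noncomputable def gaussM (A : Type*) [NormedAddCommGroup A] [InnerProductSpace ℝ A]
    [FiniteDimensional ℝ A] [MeasurableSpace A] [BorelSpace A] (b : ℝ) : Measure A :=
  (volume : Measure A).withDensity (fun x => ENNReal.ofReal
    (((Real.pi / b) ^ (Module.finrank ℝ A / 2 : ℝ))⁻¹ * Real.exp (-b * ‖x‖ ^ 2)))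

lemma integral_gaussM {b : ℝ} (hb : 0 < b) (g : A → ℂ) :
    ∫ x, g x ∂(gaussM A b) = (((Real.pi / b) ^ (Module.finrank ℝ A / 2 : ℝ))⁻¹ : ℝ) *
      ∫ x, cexp (-b * ‖x‖ ^ 2) * g x := by
  have hK : 0 < Real.pi / b := by positivity
  rw [gaussM, integral_withDensity_eq_integral_toReal_smul (by fun_prop)
    (ae_of_all _ fun _ => ENNReal.ofReal_lt_top), ← integral_const_mul]
  congr 1
  ext x
  rw [ENNReal.toReal_ofReal (by positivity), Complex.real_smul]
  push_cast
  ring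

lemma charFun_gaussM {b : ℝ} (hb : 0 < b) (t : A) :
    charFun (gaussM A b) t = cexp (-‖t‖ ^ 2 / (4 * b)) := by
  have hK : 0 < Real.pi / b := by positivity
  rw [charFun_apply, integral_gaussM hb]
  have := GaussianFourier.integral_cexp_neg_mul_sq_norm_add (V := A) (b := (b : ℂ))
    (by simpa using hb) I t
  simp_rw [← Complex.exp_add]
  simp_rw [real_inner_comm t, mul_comm (_ : ℂ) I]
  rw [this]
  have e : ((Real.pi : ℂ) / b) ^ (Module.finrank ℝ A / 2 : ℂ) =
      (((Real.pi / b) ^ (Module.finrank ℝ A / 2 : ℝ) : ℝ) : ℂ) := by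
    rw [Complex.ofReal_cpow hK.le]; push_cast; rfl
  rw [e, ← mul_assoc, ← Complex.ofReal_mul, inv_mul_cancel₀ (by positivity)]
  simp

lemma isProb_gaussM {b : ℝ} (hb : 0 < b) : IsProbabilityMeasure (gaussM A b) := by
  have h := charFun_gaussM (A := A) hb 0
  rw [charFun_zero] at h
  simp at h
  constructor
  have h' : (gaussM A b).real Set.univ = 1 := by exact_mod_cast h
  rw [Measure.real, ENNReal.toReal_eq_one_iff] at h'
  exact h'

lemma gaussM_sub {b : ℝ} (hb : 0 < b) :
    ((gaussM A (2 * b)).prod (gaussM A (2 * b))).map (fun p => p.1 - p.2) = gaussM A b := by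
  have := isProb_gaussM (A := A) hb
  have h2 : 0 < 2 * b := by positivity
  have := isProb_gaussM (A := A) h2
  have : IsFiniteMeasure
      (((gaussM A (2 * b)).prod (gaussM A (2 * b))).map (fun p => p.1 - p.2)) := by
    infer_instance
  apply Measure.ext_of_charFun
  ext t
  rw [charFun_apply, integral_map (by fun_prop) (by fun_prop)]
  have : ∀ p : A × A, cexp (⟪p.1 - p.2, t⟫ * I) = cexp (⟪p.1, t⟫ * I) * cexp (⟪p.2, -t⟫ * I) := by
    intro p
    rw [← Complex.exp_add, inner_sub_left, inner_neg_right]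
    push_cast
    ring_nf
  simp_rw [this]
  rw [integral_prod_mul (fun x : A => cexp (⟪x, t⟫ * I)) (fun x : A => cexp (⟪x, -t⟫ * I)),
    ← charFun_apply, ← charFun_apply, charFun_gaussM h2, charFun_gaussM h2, charFun_gaussM hb,
    ← Complex.exp_add, norm_neg]
  congr 1
  push_cast
  field_simp
  ring

lemma IsPosDefFn.fourier_nonneg {Γ : A → ℂ} (h : IsPosDefFn Γ) (hc : Continuous Γ)
    {b : ℝ} (hb : 0 < b) (w : A) : 0 ≤ 𝓕 (fun x => cexp (-b * ‖x‖ ^ 2) * Γ x) w := by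
  have h2 : 0 < 2 * b := by positivity
  have := isProb_gaussM (A := A) h2
  have hK : 0 < Real.pi / b := by positivity
  have h1 := (h.mul_char (-(2 * Real.pi) • w)).integral_prod (by fun_prop) (gaussM A (2 * b))
  have h3 : ∫ u, Γ u * cexp (⟪u, -(2 * Real.pi) • w⟫ * I) ∂(gaussM A b) =
     ∫ p, Γ (p.1 - p.2) * cexp (⟪p.1 - p.2, -(2 * Real.pi) • w⟫ * I)
      ∂((gaussM A (2 * b)).prod (gaussM A (2 * b))) := by
    rw [← gaussM_sub hb, integral_map (by fun_prop)]
    exact Continuous.aestronglyMeasurable (by fun_prop)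
  rw [← h3, integral_gaussM hb] at h1
  have h4 : ∫ x, cexp (-b * ‖x‖ ^ 2) * (Γ x * cexp (⟪x, -(2 * Real.pi) • w⟫ * I)) =
     𝓕 (fun x => cexp (-b * ‖x‖ ^ 2) * Γ x) w := by
    rw [Real.fourier_eq']
    congr 1
    ext x
    rw [inner_smul_right, smul_eq_mul]
    push_cast
    ring_nf
  rw [h4] at h1
  have hpos : 0 < ((Real.pi / b) ^ (Module.finrank ℝ A / 2 : ℝ))⁻¹ := by positivity
  rw [Complex.nonneg_iff, Complex.re_ofReal_mul, Complex.im_ofReal_mul] at h1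
  rw [Complex.nonneg_iff]
  exact ⟨nonneg_of_mul_nonneg_right h1.1 hpos,
    ((mul_eq_zero.1 h1.2.symm).resolve_left hpos.ne').symm⟩

lemma integrable_fourier_of_nonneg {f : A → ℂ} (hf : Integrable f) (hc : Continuous f)
    (hpos : ∀ w, 0 ≤ 𝓕 f w) : Integrable (𝓕 f) := by
  have hFc : Continuous (𝓕 f) := by
    exact VectorFourier.fourierIntegral_continuous Real.continuous_fourierChar
      (by exact continuous_inner) hf
  have hre : ∀ w, 𝓕 f w = ((𝓕 f w).re : ℂ) := fun w => by
    apply Complex.ext <;> simp [← (Complex.nonneg_iff.1 (hpos w)).2]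
  have hre0 : ∀ w, 0 ≤ (𝓕 f w).re := fun w => (Complex.nonneg_iff.1 (hpos w)).1
  have T := Real.tendsto_integral_gaussian_smul' hf (v := 0) hc.continuousAt
  have T2 : Tendsto (fun (c : ℝ) ↦ (∫ w : A, cexp (- c⁻¹ * ‖w‖ ^ 2) • (𝓕 f) w)) atTop
      (𝓝 (f 0)) := by
    apply T.congr'
    filter_upwards [Ioi_mem_atTop 0] with c (hc : 0 < c)
    have J : Integrable (fun w : A ↦ cexp (- c⁻¹ * ‖w‖ ^ 2)) := by
      simpa using GaussianFourier.integrable_cexp_neg_mul_sq_norm_add (V := A)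
        (b := (c : ℂ)⁻¹) (by simpa [← Complex.ofReal_inv] using hc) 0 0
    have := (VectorFourier.integral_fourierIntegral_smul_eq_flip (L := innerₗ A)
      Real.continuous_fourierChar continuous_inner J hf)
    trans ∫ w : A, 𝓕 (fun w : A ↦ cexp (- c⁻¹ * ‖w‖ ^ 2)) w • f w
    · congr with w
      rw [fourier_gaussian_innerProductSpace (by simpa [← Complex.ofReal_inv] using hc)]
      have e1 : (Real.pi : ℂ) / ((c⁻¹ : ℝ) : ℂ) = Real.pi * c := by push_cast; simp
      have e2 : -(Real.pi : ℂ) ^ 2 * ‖w‖ ^ 2 / ((c⁻¹ : ℝ) : ℂ) =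
          -(Real.pi : ℂ) ^ 2 * c * ‖0 - w‖ ^ 2 := by
        rw [zero_sub, norm_neg]; push_cast; rw [div_inv_eq_mul]; ring
      rw [e1, e2]
    · simpa using! this
  have T3 : Tendsto (fun n : ℕ => ∫⁻ w : A, ENNReal.ofReal
      (Real.exp (-(n : ℝ)⁻¹ * ‖w‖ ^ 2) * (𝓕 f w).re)) atTop (𝓝 (ENNReal.ofReal (f 0).re)) := by
    have := (ENNReal.continuous_ofReal.tendsto _).comp
      ((Complex.continuous_re.tendsto _).comp (T2.comp tendsto_natCast_atTop_atTop))
    apply this.congr'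
    filter_upwards [eventually_gt_atTop 0] with n hn
    have hn' : (0 : ℝ) < n := by exact_mod_cast hn
    have e : ∀ w : A, cexp (-((n : ℝ)⁻¹ : ℝ) * ‖w‖ ^ 2) • 𝓕 f w =
        ((Real.exp (-(n : ℝ)⁻¹ * ‖w‖ ^ 2) * (𝓕 f w).re : ℝ) : ℂ) := by
      intro w
      conv_lhs => rw [hre w]
      push_cast; simp
    simp only [Function.comp_apply]
    rw [← ofReal_integral_eq_lintegral_ofReal]
    · simp_rw [e]
      rw [integral_complex_ofReal, Complex.ofReal_re]
    · have J : Integrable (fun w : A ↦ cexp (-((n : ℝ)⁻¹ : ℝ) * ‖w‖ ^ 2)) := by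
        simpa using GaussianFourier.integrable_cexp_neg_mul_sq_norm_add (V := A)
          (b := ((n : ℝ) : ℂ)⁻¹) (by rw [← Complex.ofReal_inv, Complex.ofReal_re]; positivity) 0 0
      have : Integrable (fun w : A => cexp (-((n : ℝ)⁻¹ : ℝ) * ‖w‖ ^ 2) • 𝓕 f w) := by
        refine J.mul_bdd (c := ∫ v, ‖f v‖) hFc.aestronglyMeasurable (ae_of_all _ fun w => ?_)
        exact VectorFourier.norm_fourierIntegral_le_integral_norm _ _ _ _ _
      simp_rw [e] at this
      exact this.re
    · exact ae_of_all _ fun w => mul_nonneg (Real.exp_pos _).le (hre0 w)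
  have hmeas : ∀ n : ℕ, Measurable (fun w : A => ENNReal.ofReal
      (Real.exp (-(n : ℝ)⁻¹ * ‖w‖ ^ 2) * (𝓕 f w).re)) := by
    intro n
    refine ENNReal.measurable_ofReal.comp (Continuous.measurable ?_)
    have := Complex.continuous_re.comp hFc
    exact Continuous.mul (by fun_prop) this
  have hF := lintegral_liminf_le (μ := (volume : Measure A)) (u := atTop) hmeas
  rw [T3.liminf_eq] at hF
  have lim : ∀ w : A, liminf (fun n : ℕ => ENNReal.ofReal
      (Real.exp (-(n : ℝ)⁻¹ * ‖w‖ ^ 2) * (𝓕 f w).re)) atTop = ENNReal.ofReal ((𝓕 f w).re) := by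
    intro w
    apply Tendsto.liminf_eq
    apply (ENNReal.continuous_ofReal.tendsto _).comp
    have : Tendsto (fun n : ℕ => Real.exp (-(n : ℝ)⁻¹ * ‖w‖ ^ 2) * (𝓕 f w).re) atTop
        (𝓝 (Real.exp (-0 * ‖w‖ ^ 2) * (𝓕 f w).re)) :=
      ((Real.continuous_exp.tendsto _).comp
        ((tendsto_inv_atTop_nhds_zero_nat (𝕜 := ℝ)).neg.mul_const _)).mul_const _
    simpa using this
  simp_rw [lim] at hF
  refine ⟨hFc.aestronglyMeasurable, ?_⟩
  rw [hasFiniteIntegral_iff_norm]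
  refine lt_of_le_of_lt (le_trans (lintegral_mono fun w => ?_) hF) ENNReal.ofReal_lt_top
  rw [hre w, Complex.norm_real, Real.norm_of_nonneg (hre0 w)]
  simp

lemma IsPosDefFn.bochner_approx {Γ : A → ℂ} (h : IsPosDefFn Γ) (hc : Continuous Γ)
    (h1 : Γ 0 = 1) {b : ℝ} (hb : 0 < b) :
    ∃ μ : ProbabilityMeasure A, ∀ t, charFun (μ : Measure A) t = cexp (-b * ‖t‖ ^ 2) * Γ t := by
  set f : A → ℂ := fun x => cexp (-b * ‖x‖ ^ 2) * Γ x with hfdef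
  have hfc : Continuous f := by fun_prop
  have hf : Integrable f := by
    have J : Integrable (fun w : A ↦ cexp (-b * ‖w‖ ^ 2)) := by
      simpa using GaussianFourier.integrable_cexp_neg_mul_sq_norm_add (V := A)
        (b := (b : ℂ)) (by simpa using hb) 0 0
    exact J.mul_bdd (c := (Γ 0).re) hc.aestronglyMeasurable (ae_of_all _ fun w => h.bound w)
  have hpos : ∀ w, 0 ≤ 𝓕 f w := h.fourier_nonneg hc hb
  have hFi := integrable_fourier_of_nonneg hf hfc hpos
  have hFc : Continuous (𝓕 f) := by
    exact VectorFourier.fourierIntegral_continuous Real.continuous_fourierChar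
      (by exact continuous_inner) hf
  have hrec : Continuous (fun w => (𝓕 f w).re) := Complex.continuous_re.comp hFc
  have hre : ∀ w, 𝓕 f w = ((𝓕 f w).re : ℂ) := fun w => by
    apply Complex.ext <;> simp [← (Complex.nonneg_iff.1 (hpos w)).2]
  have hre0 : ∀ w, 0 ≤ (𝓕 f w).re := fun w => (Complex.nonneg_iff.1 (hpos w)).1
  have hinv := hfc.fourierInv_fourier_eq hf hFi
  let μ : Measure A := volume.withDensity (fun w => ENNReal.ofReal (𝓕 f w).re)
  have hμ : ∀ t, charFun (μ.map ((2 * Real.pi) • ·)) t = f t := by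
    intro t
    rw [charFun_map_smul, charFun_apply, integral_withDensity_eq_integral_toReal_smul
      hrec.measurable.ennreal_ofReal (ae_of_all _ fun _ => ENNReal.ofReal_lt_top)]
    conv_rhs => rw [← hinv, Real.fourierInv_eq']
    congr 1
    ext w
    rw [ENNReal.toReal_ofReal (hre0 w), Complex.real_smul, ← hre w, inner_smul_right, smul_eq_mul,
      mul_comm]
  have hfin : IsFiniteMeasure μ := by
    have := hFi.re
    exact isFiniteMeasure_withDensity_ofReal this.2
  have hprob : IsProbabilityMeasure (μ.map ((2 * Real.pi) • ·)) := by
    have h0 := hμ 0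
    rw [charFun_zero] at h0
    simp [hfdef, h1] at h0
    constructor
    have h' : (μ.map ((2 * Real.pi) • ·)).real Set.univ = 1 := by exact_mod_cast h0
    rw [Measure.real, ENNReal.toReal_eq_one_iff] at h'
    exact h'
  exact ⟨⟨_, hprob⟩, hμ⟩

lemma IsPosDefFn.bochner {Γ : A → ℂ} (h : IsPosDefFn Γ) (hc : Continuous Γ)
    (h1 : Γ 0 = 1) :
    ∃ μ : ProbabilityMeasure A, ∀ t, charFun (μ : Measure A) t = Γ t := by
  choose μ hμ using fun n : ℕ => h.bochner_approx hc h1 (b := 1 / ((n : ℝ) + 1)) (by positivity)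
  have hlim : ∀ t, Tendsto (fun n => charFun (μ n : Measure A) t) atTop (𝓝 (Γ t)) := by
    intro t
    simp_rw [hμ]
    have : Tendsto (fun n : ℕ => cexp (-((1 / ((n : ℝ) + 1) : ℝ) : ℂ) * ‖t‖ ^ 2) * Γ t) atTop
        (𝓝 (cexp (-((0 : ℝ) : ℂ) * ‖t‖ ^ 2) * Γ t)) :=
      ((Complex.continuous_exp.tendsto _).comp
        (((Complex.continuous_ofReal.tendsto _).comp
          (tendsto_one_div_add_atTop_nhds_zero_nat (𝕜 := ℝ))).neg.mul_const _)).mul_const _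
    simpa using this
  have htight : IsTightMeasureSet (Set.range fun n => (μ n : Measure A)) :=
    isTightMeasureSet_of_tendsto_charFun hc.continuousAt hlim
  have hcomp : IsCompact (closure (Set.range μ)) := by
    apply isCompact_closure_of_isTightMeasureSet
    convert htight using 1
    ext ν
    simp
  obtain ⟨μ', -, hμ'⟩ := hcomp.ultrafilter_le_nhds ((hyperfilter ℕ : Ultrafilter ℕ).map μ)
    (le_trans (by simp) (Filter.monotone_principal subset_closure))
  have hμ' : Tendsto μ (hyperfilter ℕ) (𝓝 μ') := hμ'
  refine ⟨μ', fun t => ?_⟩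
  rw [ProbabilityMeasure.tendsto_iff_forall_integral_rclike_tendsto ℂ] at hμ'
  have h2 := hμ' (BoundedContinuousFunction.innerProbChar t)
  simp_rw [← charFun_eq_integral_innerProbChar] at h2
  exact tendsto_nhds_unique h2 ((hlim t).mono_left Nat.hyperfilter_le_atTop)

lemma measure_compl_zero_of_escape (H : Subgroup (A ≃ₗ[ℝ] A))
    (hescape : ∀ Ω : Set A, IsCompact Ω → Ω ⊆ {x : A | x ≠ 0} →
      ∃ hseq : ℕ → H, ∀ m n : ℕ, m ≠ n →
        Disjoint ((LinearMap.adjoint ((hseq m : A ≃ₗ[ℝ] A) : A →ₗ[ℝ] A)) '' Ω)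
                 ((LinearMap.adjoint ((hseq n : A ≃ₗ[ℝ] A) : A →ₗ[ℝ] A)) '' Ω))
    (μ : Measure A) [IsProbabilityMeasure μ]
    (hinv : ∀ h ∈ H, ∀ x : A, charFun μ ((h : A ≃ₗ[ℝ] A) x) = charFun μ x) :
    μ {x : A | x ≠ 0} = 0 := by
  have hmap : ∀ h ∈ H, μ.map (LinearMap.adjoint ((h : A ≃ₗ[ℝ] A) : A →ₗ[ℝ] A)) = μ := by
    intro h hh
    have hcont : Continuous (LinearMap.adjoint ((h : A ≃ₗ[ℝ] A) : A →ₗ[ℝ] A)) :=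
      LinearMap.continuous_of_finiteDimensional _
    have : IsFiniteMeasure (μ.map (LinearMap.adjoint ((h : A ≃ₗ[ℝ] A) : A →ₗ[ℝ] A))) := by
      infer_instance
    apply Measure.ext_of_charFun
    ext t
    rw [← hinv h hh t, charFun_apply, integral_map hcont.aemeasurable
      (Continuous.aestronglyMeasurable (by fun_prop)), charFun_apply]
    simp [LinearMap.adjoint_inner_left]
  have hinj : ∀ h : A ≃ₗ[ℝ] A, Function.Injective (LinearMap.adjoint (h : A →ₗ[ℝ] A)) := by
    intro h x y hxy
    refine ext_inner_right ℝ fun v => ?_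
    have := congrArg (fun z => ⟪z, h.symm v⟫) hxy
    simpa [LinearMap.adjoint_inner_left] using this
  have hcompact : ∀ Ω : Set A, IsCompact Ω → Ω ⊆ {x : A | x ≠ 0} → μ Ω = 0 := by
    intro Ω hΩ h0
    obtain ⟨hs, hd⟩ := hescape Ω hΩ h0
    let B : ℕ → Set A := fun n => (LinearMap.adjoint ((hs n : A ≃ₗ[ℝ] A) : A →ₗ[ℝ] A)) '' Ω
    have hBm : ∀ n, MeasurableSet (B n) := fun n =>
      (hΩ.image (LinearMap.continuous_of_finiteDimensional _)).measurableSet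
    have hB : ∀ n, μ (B n) = μ Ω := by
      intro n
      conv_lhs => rw [← hmap _ (hs n).2]
      rw [Measure.map_apply (LinearMap.continuous_of_finiteDimensional _).measurable (hBm n),
        Set.preimage_image_eq _ (hinj _)]
    have hU := measure_iUnion (μ := μ) (f := B) (fun m n hmn => hd m n hmn) hBm
    simp_rw [hB] at hU
    by_contra hne
    rw [ENNReal.tsum_const_eq_top_of_ne_zero hne] at hU
    exact measure_ne_top μ _ hU
  have hopen : IsOpen {x : A | x ≠ 0} := isOpen_ne
  rw [hopen.measure_eq_iSup_isCompact]
  simp only [ENNReal.iSup_eq_zero]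
  exact fun K hK hKc => hcompact K hKc hK

end

/-- **Proposition 3.1.** Let `A` be a finite-dimensional real inner product space and `H` a
group of linear automorphisms of `A`.  If for every compact subset `Ω` of `A ∖ {0}` there is a
sequence `(hₙ)` in `H` whose adjoints move `Ω` to pairwise disjoint sets, then every continuous
positive definite `H`-invariant function `Γ : A → ℂ` is constant. -/
theorem invariant_posdef_is_constant
    {A : Type*} [NormedAddCommGroup A] [InnerProductSpace ℝ A] [FiniteDimensional ℝ A]
    (H : Subgroup (A ≃ₗ[ℝ] A))
    (hescape : ∀ Ω : Set A, IsCompact Ω → Ω ⊆ {x : A | x ≠ 0} →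
      ∃ hseq : ℕ → H, ∀ m n : ℕ, m ≠ n →
        Disjoint ((LinearMap.adjoint ((hseq m : A ≃ₗ[ℝ] A) : A →ₗ[ℝ] A)) '' Ω)
                 ((LinearMap.adjoint ((hseq n : A ≃ₗ[ℝ] A) : A →ₗ[ℝ] A)) '' Ω))
    (Γ : A → ℂ) (hΓcont : Continuous Γ) (hΓpd : IsPosDefFn Γ)
    (hΓinv : ∀ h ∈ H, ∀ x : A, Γ ((h : A ≃ₗ[ℝ] A) x) = Γ x) :
    ∀ x y : A, Γ x = Γ y := by
  letI : MeasurableSpace A := borel A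
  haveI : BorelSpace A := ⟨rfl⟩
  have h0 := Complex.nonneg_iff.1 hΓpd.zero_nonneg
  rcases h0.1.eq_or_lt with hz | hz
  · have : ∀ x, Γ x = 0 := fun x => by
      have := hΓpd.bound x
      rw [← hz] at this
      exact norm_le_zero_iff.1 this
    intro x y
    rw [this, this]
  have e0 : Γ 0 = ((Γ 0).re : ℂ) := by
    apply Complex.ext <;> simp [← h0.2]
  set r := (Γ 0).re with hr
  have hrc : (r : ℂ) ≠ 0 := by exact_mod_cast hz.ne'
  let G : A → ℂ := fun x => ((r⁻¹ : ℝ) : ℂ) * Γ x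
  have hG : IsPosDefFn G := by
    intro n x c
    have h1 := hΓpd n x c
    have h2 : (0 : ℂ) ≤ ((r⁻¹ : ℝ) : ℂ) := by exact_mod_cast (inv_pos.2 hz).le
    refine (mul_nonneg h2 h1).trans_eq ?_
    simp only [Finset.mul_sum, G]
    refine Finset.sum_congr rfl fun i _ => Finset.sum_congr rfl fun j _ => ?_
    ring
  have hG1 : G 0 = 1 := by
    simp only [G]
    rw [e0]; push_cast
    exact inv_mul_cancel₀ hrc
  obtain ⟨μ, hμ⟩ := hG.bochner (by fun_prop) hG1
  have hm := measure_compl_zero_of_escape H hescape (μ : Measure A) (fun h hh x => by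
    rw [hμ, hμ]; simp only [G]; rw [hΓinv h hh x])
  have hae : ∀ᵐ x ∂(μ : Measure A), x = 0 := by
    rw [ae_iff]; exact hm
  have hconst : ∀ t, G t = 1 := by
    intro t
    rw [← hμ, charFun_apply]
    have : ∫ x, cexp (⟪x, t⟫ * I) ∂(μ : Measure A) = ∫ x, (1 : ℂ) ∂(μ : Measure A) := by
      apply integral_congr_ae
      filter_upwards [hae] with x hx
      simp [hx]
    rw [this]; simp
  intro x y
  have := (hconst x).trans (hconst y).symm
  simp only [G] at this
  exact mul_left_cancel₀ (by push_cast; exact inv_ne_zero hrc) this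
end

section
/- Let Φ = (Φ(x))_{x∈ℝⁿ} be a centered real-valued Gaussian random field on ℝⁿ with almost surely smooth sample paths, whose finite-dimensional distributions are invariant under all rigid motions x ↦ g x + b (g ∈ O(n), b ∈ ℝⁿ). Suppose its covariance function Γ(x) = E[Φ(x)Φ(0)] is twice continuously differentiable, satisfies the eigenfunction equation ∑_{i=1}^n ∂²Γ/∂xᵢ²(x) = −μ Γ(x) for some μ > 0, and Γ(0) > 0. Then for every unit vector γ ∈ ℝⁿ and every ℓ > 0, the expected number of points t in [0, ℓ] with Φ(tγ) = 0 equals (ℓ/π) √(μ/n). Equivalently, the typical spacing of Φ (the length of segment per expected zero along any line) equals π √(n/μ). -/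
open MeasureTheory ProbabilityTheory Matrix
open scoped NNReal ENNReal

lemma aux_inner (b : ℝ) (hb : 0 < b) :
    ∫⁻ u : ℝ, ENNReal.ofReal (|u| * Real.exp (-b * u ^ 2)) = ENNReal.ofReal (1 / b) := by
  have hi : Integrable (fun u : ℝ => |u| * Real.exp (-b * u ^ 2)) := by
    have := (integrable_mul_exp_neg_mul_sq hb).norm
    refine this.congr (Filter.Eventually.of_forall fun u => ?_)
    simp
  rw [← ofReal_integral_eq_lintegral_ofReal hi (Filter.Eventually.of_forall fun u => by positivity)]
  congr 1
  have h1 := integral_comp_abs (f := fun u : ℝ => u * Real.exp (-b * u ^ 2))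
  simp only [sq_abs] at h1
  rw [h1]
  have h2 := integral_rpow_mul_exp_neg_mul_rpow (p := 2) (q := 1) (b := b) (by norm_num) (by norm_num) hb
  have h3 : ∫ x in Set.Ioi (0:ℝ), x ^ (1:ℝ) * Real.exp (-b * x ^ (2:ℝ)) =
     ∫ x in Set.Ioi (0:ℝ), x * Real.exp (-b * x ^ 2) := by
    refine setIntegral_congr_fun measurableSet_Ioi fun x hx => ?_
    simp
  rw [← h3, h2]
  norm_num [Real.rpow_neg hb.le]
  ring

lemma aux_scale (u : ℝ) (hu : u ≠ 0) (g : ℝ → ℝ≥0∞) (hg : Measurable g) :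
    ∫⁻ v, g v = ∫⁻ w, ENNReal.ofReal |u| * g (u * w) := by
  have h := Real.smul_map_volume_mul_left hu
  conv_lhs => rw [← h]
  rw [lintegral_smul_measure, lintegral_map hg (by fun_prop), lintegral_const_mul _ (by fun_prop)]
  rfl

lemma aux_cauchy (c : ℝ) :
    ∫⁻ w in Set.Iio c, ENNReal.ofReal (1 / (Real.pi * (1 + w ^ 2))) =
      ENNReal.ofReal ((Real.arctan c + Real.pi / 2) / Real.pi) := by
  rw [← ofReal_integral_eq_lintegral_ofReal]
  · congr 1
    rw [← integral_Iic_eq_integral_Iio]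
    have := integral_Iic_inv_one_add_sq (i := c)
    rw [← this, div_eq_inv_mul, ← integral_const_mul]
    congr 1; ext w
    field_simp
  · have := (integrable_inv_one_add_sq.const_mul (Real.pi⁻¹)).restrict (s := Set.Iio c)
    refine this.congr (Filter.Eventually.of_forall fun u => ?_)
    simp; ring
  · exact Filter.Eventually.of_forall fun u => by positivity

lemma aux_orthant (ρ s : ℝ) (hρ : 0 < ρ) (hs : 0 < s) :
    ((gaussianReal 0 1).prod (gaussianReal 0 1)) {p : ℝ × ℝ | p.1 * (ρ * p.1 + s * p.2) < 0} =
      ENNReal.ofReal (Real.arctan (s / ρ) / Real.pi) := by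
  have hS : MeasurableSet {p : ℝ × ℝ | p.1 * (ρ * p.1 + s * p.2) < 0} :=
    measurableSet_lt (by fun_prop) (by fun_prop)
  rw [Measure.prod_apply hS]
  have hm := measurable_gaussianPDF 0 1
  have step : ∀ u : ℝ, u ≠ 0 → (gaussianReal 0 1) (Prod.mk u ⁻¹' {p : ℝ × ℝ | p.1 * (ρ * p.1 + s * p.2) < 0})
      = ∫⁻ w in Set.Iio (-(ρ / s)), ENNReal.ofReal |u| * gaussianPDF 0 1 (u * w) := by
    intro u hu
    have hS' := measurable_prodMk_left (x := u) hS
    rw [gaussianReal_apply 0 one_ne_zero, ← lintegral_indicator hS', aux_scale u hu _ (hm.indicator hS'),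
      ← lintegral_indicator measurableSet_Iio]
    congr 1; ext w
    have : (u * w ∈ Prod.mk u ⁻¹' {p : ℝ × ℝ | p.1 * (ρ * p.1 + s * p.2) < 0}) ↔ w ∈ Set.Iio (-(ρ / s)) := by
      simp only [Set.mem_preimage, Set.mem_ofPred_eq, Set.mem_Iio]
      have : u * (ρ * u + s * (u * w)) = (u ^ 2 * s) * (w + ρ / s) := by field_simp; ring
      rw [this]
      have hp : 0 < u ^ 2 * s := by positivity
      constructor
      · intro h
        by_contra hc
        have : 0 ≤ w + ρ / s := by linarith
        have := mul_nonneg hp.le this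
        linarith
      · intro h
        exact mul_neg_of_pos_of_neg hp (by linarith)
    by_cases hw : w ∈ Set.Iio (-(ρ / s))
    · rw [Set.indicator_of_mem hw, Set.indicator_of_mem (this.2 hw)]
    · rw [Set.indicator_of_notMem hw, Set.indicator_of_notMem (fun h => hw (this.1 h)), mul_zero]
  have hna : ∀ᵐ u ∂(volume : Measure ℝ), u ≠ 0 := by
    simp [ae_iff]
  rw [gaussianReal_of_var_ne_zero 0 one_ne_zero, lintegral_withDensity_eq_lintegral_mul₀ hm.aemeasurable]
  rotate_left
  · rw [← gaussianReal_of_var_ne_zero 0 one_ne_zero]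
    exact (measurable_measure_prodMk_left hS).aemeasurable
  rw [← gaussianReal_of_var_ne_zero 0 one_ne_zero]
  have e1 : ∫⁻ u, (gaussianPDF 0 1 * fun u => (gaussianReal 0 1) (Prod.mk u ⁻¹' {p : ℝ × ℝ | p.1 * (ρ * p.1 + s * p.2) < 0})) u
      = ∫⁻ u, ∫⁻ w in Set.Iio (-(ρ / s)), gaussianPDF 0 1 u * (ENNReal.ofReal |u| * gaussianPDF 0 1 (u * w)) := by
    refine lintegral_congr_ae ?_
    filter_upwards [hna] with u hu
    rw [lintegral_const_mul _ (by fun_prop), Pi.mul_apply, step u hu]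
  rw [e1, lintegral_lintegral_swap (by fun_prop)]
  have e2 : ∀ w : ℝ, ∫⁻ u, gaussianPDF 0 1 u * (ENNReal.ofReal |u| * gaussianPDF 0 1 (u * w)) =
      ENNReal.ofReal (1 / (Real.pi * (1 + w ^ 2))) := by
    intro w
    have hb : 0 < (1 + w ^ 2) / 2 := by positivity
    have : ∀ u : ℝ, gaussianPDF 0 1 u * (ENNReal.ofReal |u| * gaussianPDF 0 1 (u * w)) =
      ENNReal.ofReal (1 / (2 * Real.pi)) * ENNReal.ofReal (|u| * Real.exp (-((1 + w ^ 2) / 2) * u ^ 2)) := by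
      intro u
      have hsq : (√(2 * Real.pi))⁻¹ * (√(2 * Real.pi))⁻¹ = 1 / (2 * Real.pi) := by
        rw [← mul_inv, Real.mul_self_sqrt (by positivity), one_div]
      rw [gaussianPDF, gaussianPDF, ← ENNReal.ofReal_mul (abs_nonneg _), ← ENNReal.ofReal_mul (gaussianPDFReal_nonneg _ _ _),
        ← ENNReal.ofReal_mul (by positivity)]
      congr 1
      simp only [gaussianPDFReal, NNReal.coe_one, mul_one, sub_zero]
      have : Real.exp (-((1 + w ^ 2) / 2) * u ^ 2) = Real.exp (-u ^ 2 / 2) * Real.exp (-(u * w) ^ 2 / 2) := by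
        rw [← Real.exp_add]; congr 1; ring
      rw [this, ← hsq]; ring
    simp_rw [this]
    rw [lintegral_const_mul _ (by fun_prop), aux_inner _ hb, ← ENNReal.ofReal_mul (by positivity)]
    congr 1
    field_simp
  simp_rw [e2]
  rw [aux_cauchy]
  congr 2
  rw [Real.arctan_neg]
  have := Real.arctan_inv_of_pos (x := s / ρ) (by positivity)
  rw [inv_div] at this
  rw [this]; ring

lemma aux_pair {Ω : Type*} [MeasurableSpace Ω] (P : Measure Ω) [IsProbabilityMeasure P]
    (X Y : Ω → ℝ) (hX : Measurable X) (hY : Measurable Y)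
    (hg : HasGaussianLaw (fun ω => (X ω, Y ω)) P)
    (hX0 : ∫ ω, X ω ∂P = 0) (hY0 : ∫ ω, Y ω ∂P = 0) (v ρ : ℝ) (hv : 0 < v)
    (hXX : ∫ ω, X ω * X ω ∂P = v) (hYY : ∫ ω, Y ω * Y ω ∂P = v) (hYX : ∫ ω, Y ω * X ω ∂P = ρ * v)
    (hρ : 0 < ρ) (hρ1 : ρ < 1) :
    P {ω | X ω * Y ω < 0} = ENNReal.ofReal (Real.arctan (√(1 - ρ ^ 2) / ρ) / Real.pi) := by
  have hX2 : MemLp X 2 P := hg.fst.memLp_two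
  have hY2 : MemLp Y 2 P := hg.snd.memLp_two
  have hs2 : 0 < 1 - ρ ^ 2 := by nlinarith
  set s := √(1 - ρ ^ 2) with hs
  have hs0 : 0 < s := Real.sqrt_pos.2 hs2
  have hss : s * s = 1 - ρ ^ 2 := Real.mul_self_sqrt hs2.le
  set σ := √v with hσ
  have hσ0 : 0 < σ := Real.sqrt_pos.2 hv
  have hσσ : σ * σ = v := Real.mul_self_sqrt hv.le
  set U : Ω → ℝ := fun ω => σ⁻¹ * X ω with hU
  set V : Ω → ℝ := fun ω => (σ * s)⁻¹ * (Y ω - ρ * X ω) with hV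
  have hUm : Measurable U := by fun_prop
  have hVm : Measurable V := by fun_prop
  have hUV : HasGaussianLaw (fun ω => (U ω, V ω)) P := by
    let L : ℝ × ℝ →L[ℝ] ℝ × ℝ :=
      (σ⁻¹ • ContinuousLinearMap.fst ℝ ℝ ℝ).prod
        ((σ * s)⁻¹ • (ContinuousLinearMap.snd ℝ ℝ ℝ - ρ • ContinuousLinearMap.fst ℝ ℝ ℝ))
    have := hg.map_fun L
    simpa [L, hU, hV] using this
  have iXX : Integrable (fun ω => X ω * X ω) P := hX2.integrable_mul hX2
  have iYY : Integrable (fun ω => Y ω * Y ω) P := hY2.integrable_mul hY2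
  have iYX : Integrable (fun ω => Y ω * X ω) P := hY2.integrable_mul hX2
  have iX : Integrable X P := hX2.integrable (by norm_num)
  have iY : Integrable Y P := hY2.integrable (by norm_num)
  have eU : ∫ ω, U ω ∂P = 0 := by simp [hU, integral_const_mul, hX0]
  have eV : ∫ ω, V ω ∂P = 0 := by
    simp only [hV]
    rw [integral_const_mul, integral_sub iY (iX.const_mul _), integral_const_mul, hX0, hY0]; simp
  have eUU : ∫ ω, U ω ^ 2 ∂P = 1 := by
    have : ∀ ω, U ω ^ 2 = v⁻¹ * (X ω * X ω) := by
      intro ω; simp only [hU]; rw [← hσσ]; field_simp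
    simp_rw [this]; rw [integral_const_mul, hXX]; field_simp
  have eVV : ∫ ω, V ω ^ 2 ∂P = 1 := by
    have : ∀ ω, V ω ^ 2 = (v * (1 - ρ ^ 2))⁻¹ * (Y ω * Y ω - (2 * ρ) * (Y ω * X ω) + ρ ^ 2 * (X ω * X ω)) := by
      intro ω; simp only [hV]; rw [← hσσ, ← hss]; field_simp; ring
    have iS : Integrable (fun ω => Y ω * Y ω - (2 * ρ) * (Y ω * X ω)) P := iYY.sub (iYX.const_mul _)
    simp_rw [this]
    rw [integral_const_mul, integral_add iS (iXX.const_mul _),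
      integral_sub iYY (iYX.const_mul _), integral_const_mul, integral_const_mul, hXX, hYY, hYX]
    field_simp; ring
  have eUV : ∫ ω, U ω * V ω ∂P = 0 := by
    have : ∀ ω, U ω * V ω = (v * s)⁻¹ * (Y ω * X ω - ρ * (X ω * X ω)) := by
      intro ω; simp only [hU, hV]; rw [← hσσ]; field_simp
    simp_rw [this]; rw [integral_const_mul, 
      integral_sub iYX (iXX.const_mul _), integral_const_mul, hXX, hYX]
    simp
  have lU : P.map U = gaussianReal 0 1 := by
    rw [hUV.fst.map_eq_gaussianReal, eU, variance_of_integral_eq_zero hUm.aemeasurable eU, eUU]; simp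
  have lV : P.map V = gaussianReal 0 1 := by
    rw [hUV.snd.map_eq_gaussianReal, eV, variance_of_integral_eq_zero hVm.aemeasurable eV, eVV]; simp
  have hind : IndepFun U V P := by
    apply hUV.indepFun_of_covariance_eq_zero
    rw [covariance_eq_sub hUV.fst.memLp_two hUV.snd.memLp_two, eU, eV]
    simpa using eUV
  have hmap := hind.map_prod_eq_prod_map_map hUm.aemeasurable hVm.aemeasurable
  rw [lU, lV] at hmap
  have hS : MeasurableSet {p : ℝ × ℝ | p.1 * (ρ * p.1 + s * p.2) < 0} :=
    measurableSet_lt (by fun_prop) (by fun_prop)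
  rw [← aux_orthant ρ s hρ hs0, ← hmap, Measure.map_apply (by fun_prop) hS]
  congr 1
  ext ω
  simp only [Set.mem_preimage, Set.mem_ofPred_eq]
  have : X ω * Y ω = v * (U ω * (ρ * U ω + s * V ω)) := by
    simp only [hU, hV]; rw [← hσσ]; field_simp; ring
  rw [this]
  constructor
  · intro h; by_contra hc; push Not at hc; have := mul_nonneg hv.le hc; linarith
  · intro h; exact mul_neg_of_pos_of_neg hv h

lemma aux_hasGauss {Ω : Type*} [MeasurableSpace Ω] (P : Measure Ω) [IsProbabilityMeasure P]
    (X Y : Ω → ℝ) (hX : Measurable X) (hY : Measurable Y)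
    (h : ∀ a b : ℝ, ∃ (c : ℝ) (v : ℝ≥0), Measure.map (fun ω => a * X ω + b * Y ω) P = gaussianReal c v) :
    HasGaussianLaw (fun ω => (X ω, Y ω)) P := by
  constructor
  apply isGaussian_of_map_eq_gaussianReal
  intro L
  obtain ⟨c, v, hcv⟩ := h (L (1, 0)) (L (0, 1))
  refine ⟨c, v, ?_⟩
  rw [Measure.map_map (by fun_prop) (by fun_prop), ← hcv]
  congr 1
  ext ω
  have : (X ω, Y ω) = X ω • ((1 : ℝ), (0 : ℝ)) + Y ω • ((0 : ℝ), (1 : ℝ)) := by simp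
  simp only [Function.comp]
  rw [this, map_add, map_smul, map_smul]
  simp [mul_comm]

lemma aux_small (σ2 : ℝ≥0) (h : σ2 ≠ 0) (ε : ℝ) :
    gaussianReal 0 σ2 (Set.Icc (-ε) ε) ≤ ENNReal.ofReal ((√(2 * Real.pi * σ2))⁻¹ * (2 * ε)) := by
  rw [gaussianReal_apply 0 h]
  calc _ ≤ ∫⁻ x in Set.Icc (-ε) ε, ENNReal.ofReal ((√(2 * Real.pi * σ2))⁻¹) := by
        refine lintegral_mono fun x => ?_
        refine ENNReal.ofReal_le_ofReal ?_
        rw [gaussianPDFReal]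
        refine mul_le_of_le_one_right (by positivity) ?_
        rw [Real.exp_le_one_iff]
        have : 0 ≤ (x - 0) ^ 2 / (2 * (σ2 : ℝ)) := by positivity
        rw [neg_div]; linarith
    _ = _ := by
        rw [lintegral_const, Measure.restrict_apply_univ, Real.volume_Icc, ← ENNReal.ofReal_mul (by positivity)]
        congr 2; ring

lemma det_le (f : ℝ → ℝ) (hf : Continuous f) (ℓ h : ℝ) (hh : 0 < h) (k : ℕ) (hk : k * h ≤ ℓ) :
    (∑ j ∈ Finset.range k, if f (j * h) * f ((j + 1 : ℕ) * h) < 0 then (1 : ℝ≥0∞) else 0) ≤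
      ({t : ℝ | t ∈ Set.Icc 0 ℓ ∧ f t = 0}.encard : ℝ≥0∞) := by
  classical
  rw [Finset.sum_boole]
  set S := (Finset.range k).filter (fun j : ℕ => f (j * h) * f ((j + 1 : ℕ) * h) < 0) with hS
  have key : ∀ j ∈ S, ∃ z, z ∈ Set.Ioo (j * h) ((j + 1 : ℕ) * h) ∧ f z = 0 := by
    intro j hj
    have hj2 : f (j * h) * f ((j + 1 : ℕ) * h) < 0 := (Finset.mem_filter.1 hj).2
    have hle : (j : ℝ) * h ≤ (j + 1 : ℕ) * h := by push_cast; nlinarith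
    rcases mul_neg_iff.1 hj2 with ⟨h1, h2⟩ | ⟨h1, h2⟩
    · obtain ⟨z, hz, hz0⟩ := intermediate_value_Ioo' hle hf.continuousOn ⟨h2, h1⟩
      exact ⟨z, hz, hz0⟩
    · obtain ⟨z, hz, hz0⟩ := intermediate_value_Ioo hle hf.continuousOn ⟨h1, h2⟩
      exact ⟨z, hz, hz0⟩
  choose! z hz hz0 using key
  have inj : Set.InjOn z S := by
    intro i hi j hj hij
    have h1 := hz i hi
    have h2 := hz j hj
    rw [hij] at h1
    have a1 := h1.1.trans h2.2
    have a2 := h2.1.trans h1.2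
    have b1 : (i : ℝ) < (j + 1 : ℕ) := lt_of_mul_lt_mul_right a1 hh.le
    have b2 : (j : ℝ) < (i + 1 : ℕ) := lt_of_mul_lt_mul_right a2 hh.le
    have c1 : i < j + 1 := by exact_mod_cast b1
    have c2 : j < i + 1 := by exact_mod_cast b2
    omega
  have hsub : z '' (S : Set ℕ) ⊆ {t : ℝ | t ∈ Set.Icc 0 ℓ ∧ f t = 0} := by
    rintro _ ⟨j, hj, rfl⟩
    have h1 := hz j hj
    have hjk : j < k := Finset.mem_range.1 (Finset.mem_filter.1 hj).1
    have hjk' : ((j + 1 : ℕ) : ℝ) ≤ k := by exact_mod_cast hjk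
    refine ⟨⟨?_, ?_⟩, hz0 j hj⟩
    · have : 0 ≤ (j : ℝ) * h := by positivity
      linarith [h1.1]
    · have := mul_le_mul_of_nonneg_right hjk' hh.le
      linarith [h1.2]
  have h3 := Set.encard_le_encard hsub
  rw [inj.encard_image, Set.encard_coe_eq_coe_finsetCard] at h3
  have h4 : (((S.card : ℕ∞) : ℝ≥0∞)) ≤ _ := ENat.toENNReal_le.2 h3
  simpa using h4

lemma det_sign (f : ℝ → ℝ) (z : ℝ) (hf : DifferentiableAt ℝ f z) (hz : f z = 0) (hd : deriv f z ≠ 0) :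
    ∃ δ > 0, ∀ s t, z - δ < s → s < z → z < t → t < z + δ → f s * f t < 0 := by
  have hD := hasDerivAt_iff_tendsto_slope.1 hf.hasDerivAt
  have hev : ∀ᶠ x in nhdsWithin z {z}ᶜ, 0 < deriv f z * slope f z x := by
    have h1 : Filter.Tendsto (fun x => deriv f z * slope f z x) (nhdsWithin z {z}ᶜ)
        (nhds (deriv f z * deriv f z)) := hD.const_mul _
    exact h1.eventually (lt_mem_nhds (mul_self_pos.2 hd))
  rw [eventually_nhdsWithin_iff, Metric.eventually_nhds_iff] at hev
  obtain ⟨δ, hδ, H⟩ := hev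
  refine ⟨δ, hδ, fun s t h1 h2 h3 h4 => ?_⟩
  have hs := H (y := s) (by rw [Real.dist_eq, abs_lt]; constructor <;> linarith) (by simp; exact h2.ne)
  have ht := H (y := t) (by rw [Real.dist_eq, abs_lt]; constructor <;> linarith) (by simp; exact h3.ne')
  rw [slope_def_field, hz, sub_zero] at hs ht
  have e1 : 0 < deriv f z ^ 2 * ((f s / (s - z)) * (f t / (t - z))) := by
    have := mul_pos hs ht; nlinarith
  have e2 : 0 < (f s / (s - z)) * (f t / (t - z)) := by
    by_contra hc
    push Not at hc
    have := mul_nonpos_of_nonneg_of_nonpos (sq_nonneg (deriv f z)) hc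
    linarith
  have e3 : f s * f t = (f s / (s - z)) * (f t / (t - z)) * ((s - z) * (t - z)) := by
    have : s - z ≠ 0 := by linarith
    have : t - z ≠ 0 := by linarith
    field_simp
  rw [e3]
  exact mul_neg_of_pos_of_neg e2 (mul_neg_of_neg_of_pos (by linarith) (by linarith))

lemma det_ge_fin (f : ℝ → ℝ) (hf : Differentiable ℝ f) (ℓ : ℝ) (hℓ : 0 < ℓ)
    (hgrid : ∀ k : ℕ, ∀ j : ℕ, f (j * (ℓ / k)) ≠ 0)
    (htr : ∀ z ∈ Set.Icc 0 ℓ, f z = 0 → deriv f z ≠ 0)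
    (F : Finset ℝ) (hF : ∀ z ∈ F, z ∈ Set.Icc 0 ℓ ∧ f z = 0) :
    ∀ᶠ k : ℕ in Filter.atTop, (F.card : ℝ≥0∞) ≤
      ∑ j ∈ Finset.range k, if f (j * (ℓ / k)) * f ((j + 1 : ℕ) * (ℓ / k)) < 0 then (1 : ℝ≥0∞) else 0 := by
  classical
  have hlim : Filter.Tendsto (fun k : ℕ => ℓ / (k : ℝ)) Filter.atTop (nhds 0) :=
    tendsto_const_div_atTop_nhds_zero_nat ℓ
  have h1 : ∀ᶠ k : ℕ in Filter.atTop, ∀ z ∈ F, ∀ s t, z - ℓ / k < s → s < z → z < t → t < z + ℓ / k → f s * f t < 0 := by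
    rw [Filter.eventually_all_finset]
    intro z hz
    obtain ⟨δ, hδ, H⟩ := det_sign f z (hf z) (hF z hz).2 (htr z (hF z hz).1 (hF z hz).2)
    filter_upwards [hlim.eventually (gt_mem_nhds hδ)] with k hk s t a b c d
    exact H s t (by linarith) b c (by linarith)
  have h2 : ∀ᶠ k : ℕ in Filter.atTop, ∀ z ∈ F, ∀ z' ∈ F, z ≠ z' → ℓ / k < |z - z'| := by
    rw [Filter.eventually_all_finset]
    intro z hz
    rw [Filter.eventually_all_finset]
    intro z' hz'
    by_cases hzz : z = z'
    · simp [hzz]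
    · filter_upwards [hlim.eventually (gt_mem_nhds (abs_pos.2 (sub_ne_zero.2 hzz)))] with k hk _
      exact hk
  filter_upwards [h1, h2, Filter.eventually_gt_atTop 0] with k a1 a2 hk
  have hk' : (0 : ℝ) < k := by exact_mod_cast hk
  set h := ℓ / k with hh
  have h0 : 0 < h := by positivity
  have hkh : k * h = ℓ := by rw [hh]; field_simp
  rw [Finset.sum_boole]
  have fl : ∀ z ∈ F, (⌊z / h⌋₊ : ℝ) * h < z ∧ z < (⌊z / h⌋₊ + 1 : ℕ) * h := by
    intro z hz
    have hz0 := (hF z hz).1.1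
    have b1 := Nat.floor_le (a := z / h) (by positivity)
    have b2 := Nat.lt_floor_add_one (z / h)
    rw [le_div_iff₀ h0] at b1
    rw [div_lt_iff₀ h0] at b2
    refine ⟨lt_of_le_of_ne b1 fun he => ?_, by push_cast; exact b2⟩
    have := hgrid k ⌊z / h⌋₊
    rw [← hh, he] at this
    exact this (hF z hz).2
  have : F.card ≤ ((Finset.range k).filter (fun j : ℕ => f (j * h) * f ((j + 1 : ℕ) * h) < 0)).card := by
    refine Finset.card_le_card_of_injOn (fun z => ⌊z / h⌋₊) ?_ ?_
    · intro z hz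
      have b := fl z hz
      simp only [Finset.coe_filter, Finset.mem_range, Set.mem_ofPred_eq]
      constructor
      · have : (⌊z / h⌋₊ : ℝ) * h < k * h := by rw [hkh]; exact b.1.trans_le (hF z hz).1.2
        exact_mod_cast lt_of_mul_lt_mul_right this h0.le
      · have b2 := b.2
        refine a1 z hz _ _ ?_ b.1 b.2 ?_
        · push_cast at b2; linarith
        · push_cast; linarith [b.1]
    · intro z hz z' hz' he
      by_contra hne
      have b := fl z hz
      have b' := fl z' hz'
      simp only at he
      rw [← he] at b'
      have := a2 z hz z' hz' hne
      obtain ⟨c1, c2⟩ := b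
      obtain ⟨c1', c2'⟩ := b'
      push_cast at c2 c2'
      have : |z - z'| < h := by rw [abs_lt]; constructor <;> linarith
      linarith
  exact_mod_cast this

lemma det_ge (f : ℝ → ℝ) (hf : Differentiable ℝ f) (ℓ : ℝ) (hℓ : 0 < ℓ)
    (hgrid : ∀ k : ℕ, ∀ j : ℕ, f (j * (ℓ / k)) ≠ 0)
    (htr : ∀ z ∈ Set.Icc 0 ℓ, f z = 0 → deriv f z ≠ 0) :
    ({t : ℝ | t ∈ Set.Icc 0 ℓ ∧ f t = 0}.encard : ℝ≥0∞) ≤ Filter.liminf (fun k : ℕ => 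
      ∑ j ∈ Finset.range k, if f (j * (ℓ / k)) * f ((j + 1 : ℕ) * (ℓ / k)) < 0 then (1 : ℝ≥0∞) else 0) Filter.atTop := by
  set Z := {t : ℝ | t ∈ Set.Icc 0 ℓ ∧ f t = 0} with hZ
  by_cases hfin : Z.Finite
  · rw [hfin.encard_eq_coe_toFinset_card]
    have := det_ge_fin f hf ℓ hℓ hgrid htr hfin.toFinset (fun z hz => hfin.mem_toFinset.1 hz)
    simpa using Filter.le_liminf_of_le (by isBoundedDefault) this
  · have hinf : Z.Infinite := hfin
    have : ∀ m : ℕ, (m : ℝ≥0∞) ≤ Filter.liminf (fun k : ℕ => 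
      ∑ j ∈ Finset.range k, if f (j * (ℓ / k)) * f ((j + 1 : ℕ) * (ℓ / k)) < 0 then (1 : ℝ≥0∞) else 0) Filter.atTop := by
      intro m
      obtain ⟨F, hF, hc⟩ := hinf.exists_subset_card_eq m
      have := det_ge_fin f hf ℓ hℓ hgrid htr F (fun z hz => hF hz)
      rw [hc] at this
      exact Filter.le_liminf_of_le (by isBoundedDefault) this
    have h2 := ENNReal.eq_top_of_forall_nnreal_le (x := Filter.liminf (fun k : ℕ => 
      ∑ j ∈ Finset.range k, if f (j * (ℓ / k)) * f ((j + 1 : ℕ) * (ℓ / k)) < 0 then (1 : ℝ≥0∞) else 0) Filter.atTop) (by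
        intro r
        obtain ⟨m, hm⟩ := exists_nat_ge r
        exact le_trans (by exact_mod_cast hm) (this m))
    rw [h2]; exact le_top

lemma det_tang (f : ℝ → ℝ) (hf : ContDiff ℝ 2 f) (ℓ : ℝ) (hℓ : 0 < ℓ) (M : ℝ)
    (hM : ∀ x ∈ Set.Icc 0 ℓ, |deriv (deriv f) x| ≤ M) (z : ℝ) (hz : z ∈ Set.Icc 0 ℓ) (hz0 : f z = 0)
    (hd : deriv f z = 0) (k : ℕ) (hk : 0 < k) :
    ∃ j ∈ Finset.range (k + 1), |f (j * (ℓ / k))| ≤ M * (ℓ / k) ^ 2 := by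
  have hk' : (0 : ℝ) < k := by exact_mod_cast hk
  set h := ℓ / k with hh
  have h0 : 0 < h := by positivity
  have hkh : k * h = ℓ := by rw [hh]; field_simp
  have hM0 : 0 ≤ M := (abs_nonneg _).trans (hM z hz)
  have b1 := Nat.floor_le (a := z / h) (div_nonneg hz.1 h0.le)
  have b2 := Nat.lt_floor_add_one (z / h)
  rw [le_div_iff₀ h0] at b1
  rw [div_lt_iff₀ h0] at b2
  set j := ⌊z / h⌋₊
  have hjk : j ≤ k := by
    have : (j : ℝ) * h ≤ k * h := by rw [hkh]; exact b1.trans hz.2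
    exact_mod_cast le_of_mul_le_mul_right this h0
  refine ⟨j, Finset.mem_range.2 (by omega), ?_⟩
  have hx0 : 0 ≤ (j : ℝ) * h := by positivity
  set x := (j : ℝ) * h with hx
  have hd1 : Differentiable ℝ f := hf.differentiable (by norm_num)
  have hd2 : Differentiable ℝ (deriv f) :=
    ((contDiff_succ_iff_deriv (n := 1)).1 (by simpa [one_add_one_eq_two] using hf)).2.2.differentiable (by norm_num)
  have step1 : ∀ y ∈ Set.Icc x z, ‖deriv f y‖ ≤ M * h := by
    intro y hy
    have hy' : y ∈ Set.Icc 0 ℓ := ⟨hx0.trans hy.1, hy.2.trans hz.2⟩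
    have := (convex_Icc 0 ℓ).norm_image_sub_le_of_norm_deriv_le (f := deriv f) (fun w _ => hd2 w)
      (fun w hw => hM w hw) hz hy'
    rw [hd, sub_zero] at this
    refine this.trans (mul_le_mul_of_nonneg_left ?_ hM0)
    rw [Real.norm_eq_abs, abs_le]
    constructor <;> linarith [hy.1, hy.2]
  have := (convex_Icc x z).norm_image_sub_le_of_norm_deriv_le (f := f) (fun w _ => hd1 w)
      step1 ⟨b1, le_rfl⟩ ⟨le_rfl, b1⟩
  rw [hz0, sub_zero, Real.norm_eq_abs] at this
  refine this.trans ?_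
  rw [sq, ← mul_assoc]
  refine mul_le_mul_of_nonneg_left ?_ (by positivity)
  rw [Real.norm_eq_abs, abs_le]
  constructor <;> linarith

lemma geom_rot (n : ℕ) (γ : Fin n → ℝ) (hγ : ∑ i, γ i ^ 2 = 1) (i : Fin n) :
    ∃ g : Matrix (Fin n) (Fin n) ℝ, g * gᵀ = 1 ∧ g.mulVec (Pi.single i 1) = γ := by
  by_cases hne : (Pi.single i 1 : Fin n → ℝ) = γ
  · exact ⟨1, by simp, by simp [hne]⟩
  set w : Fin n → ℝ := Pi.single i 1 - γ with hw
  have hw0 : w ≠ 0 := sub_ne_zero.2 hne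
  have hγγ : γ ⬝ᵥ γ = 1 := by rw [← hγ]; simp [dotProduct, sq]
  have hww : w ⬝ᵥ w = 2 * (w ⬝ᵥ Pi.single i 1) := by
    have : w ⬝ᵥ w = 2 - 2 * γ i := by
      simp [hw, sub_dotProduct, dotProduct_sub, hγγ]; ring
    rw [this]; simp [hw]; ring
  have hpos : w ⬝ᵥ w ≠ 0 := fun h => hw0 (dotProduct_self_eq_zero.1 h)
  set c : ℝ := 2 / (w ⬝ᵥ w) with hc
  refine ⟨1 - c • vecMulVec w w, ?_, ?_⟩
  · have hv : vecMulVec w w * vecMulVec w w = (w ⬝ᵥ w) • vecMulVec w w := by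
      rw [vecMulVec_mul_vecMulVec]; ext a b; simp [vecMulVec_apply]; ring
    have ht : (1 - c • vecMulVec w w)ᵀ = 1 - c • vecMulVec w w := by
      ext a b
      simp [vecMulVec_apply, Matrix.one_apply, eq_comm, mul_comm]
    rw [ht, sub_mul, mul_sub, mul_sub, smul_mul_smul_comm, hv]
    have h2 : c * c * (w ⬝ᵥ w) = 2 * c := by rw [hc]; field_simp
    rw [smul_smul, h2]
    simp only [mul_one, one_mul]
    module
  · rw [sub_mulVec, smul_mulVec, vecMulVec_mulVec, one_mulVec]
    have : c * (w ⬝ᵥ Pi.single i 1) = 1 := by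
      have h0 : w ⬝ᵥ Pi.single i 1 ≠ 0 := fun h => hpos (by rw [hww, h, mul_zero])
      rw [hc, hww, div_mul_eq_mul_div, div_self (mul_ne_zero two_ne_zero h0)]
    ext a
    have h3 : ((c • MulOpposite.op (w ⬝ᵥ Pi.single i 1) • w) a) = w a := by
      have : c * (w ⬝ᵥ Pi.single i 1) * w a = w a := by rw [this, one_mul]
      simp only [Pi.smul_apply, smul_eq_mul, MulOpposite.smul_eq_mul_unop, MulOpposite.unop_op]
      linarith
    rw [Pi.sub_apply, h3, hw]
    simp

lemma asym_r (r : ℝ → ℝ) (hr : ContDiff ℝ 2 r) (heven : ∀ t, r (-t) = r t) (κ : ℝ)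
    (hd : deriv (deriv r) 0 = -κ * r 0) :
    Filter.Tendsto (fun t => (r 0 - r t) / t ^ 2) (nhdsWithin 0 (Set.Ioi 0)) (nhds (κ * r 0 / 2)) := by
  have hd1 : Differentiable ℝ r := hr.differentiable (by norm_num)
  have h0 : deriv r 0 = 0 := by
    have h1 : deriv (fun t => r (-t)) 0 = - deriv r (-0) := deriv_comp_neg r 0
    have : (fun t => r (-t)) = r := funext heven
    rw [this] at h1
    simp at h1
    linarith
  have T := Real.taylor_tendsto (f := r) (x₀ := 0) (n := 2) convex_univ (Set.mem_univ 0)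
    (by exact_mod_cast hr.contDiffOn)
  have T2 := T.mono_left (nhdsWithin_mono 0 (Set.subset_univ (Set.Ioi 0)))
  have T3 := (T2.const_sub (κ * r 0 / 2))
  rw [sub_zero] at T3
  refine T3.congr' ?_
  filter_upwards [self_mem_nhdsWithin] with t ht
  have ht0 : t ≠ 0 := ne_of_gt ht
  rw [taylorWithinEval_succ, taylorWithinEval_succ, taylor_within_zero_eval]
  have i1 : iteratedDeriv 2 r = deriv (deriv r) := by
    rw [iteratedDeriv_succ, iteratedDeriv_one]
  simp [iteratedDerivWithin_univ, i1, h0, hd]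
  field_simp
  ring

lemma asym_main (r : ℝ → ℝ) (hr : ContDiff ℝ 2 r) (heven : ∀ t, r (-t) = r t) (κ : ℝ) (hκ : 0 < κ)
    (hr0 : 0 < r 0) (hd : deriv (deriv r) 0 = -κ * r 0) (ℓ : ℝ) (hℓ : 0 < ℓ) :
    (∀ᶠ k : ℕ in Filter.atTop, 0 < r (ℓ / k) / r 0 ∧ r (ℓ / k) / r 0 < 1) ∧
    Filter.Tendsto (fun k : ℕ => (k : ℝ) * (Real.arctan (√(1 - (r (ℓ / k) / r 0) ^ 2) / (r (ℓ / k) / r 0)) / Real.pi))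
      Filter.atTop (nhds (ℓ / Real.pi * √κ)) := by
  have hlim : Filter.Tendsto (fun k : ℕ => ℓ / (k : ℝ)) Filter.atTop (nhdsWithin 0 (Set.Ioi 0)) := by
    refine tendsto_nhdsWithin_iff.2 ⟨tendsto_const_div_atTop_nhds_zero_nat ℓ, ?_⟩
    filter_upwards [Filter.eventually_gt_atTop 0] with k hk
    have : (0 : ℝ) < k := by exact_mod_cast hk
    exact div_pos hℓ this
  have A := asym_r r hr heven κ hd
  set ρ : ℝ → ℝ := fun t => r t / r 0 with hρ
  have Rho : Filter.Tendsto ρ (nhdsWithin 0 (Set.Ioi 0)) (nhds 1) := by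
    have : Filter.Tendsto ρ (nhds 0) (nhds (ρ 0)) := (hr.continuous.div_const _).tendsto 0
    have h1 : ρ 0 = 1 := by simp [hρ, hr0.ne']
    rw [h1] at this
    exact this.mono_left nhdsWithin_le_nhds
  constructor
  · have e1 : ∀ᶠ t in nhdsWithin 0 (Set.Ioi 0), 0 < ρ t := Rho.eventually (lt_mem_nhds one_pos)
    have e2 : ∀ᶠ t in nhdsWithin 0 (Set.Ioi 0), 0 < (r 0 - r t) / t ^ 2 :=
      A.eventually (lt_mem_nhds (by positivity))
    filter_upwards [hlim.eventually e1, hlim.eventually e2] with k h1 h2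
    refine ⟨h1, ?_⟩
    rw [div_lt_one hr0]
    by_contra hc
    push Not at hc
    have := div_nonpos_of_nonpos_of_nonneg (sub_nonpos.2 hc) (sq_nonneg (ℓ / (k : ℝ)))
    linarith
  · have B : Filter.Tendsto (fun t => √(1 - ρ t ^ 2) / t) (nhdsWithin 0 (Set.Ioi 0)) (nhds (√κ)) := by
      have B1 : Filter.Tendsto (fun t => √((r 0 - r t) / t ^ 2 / r 0 * (1 + ρ t))) (nhdsWithin 0 (Set.Ioi 0))
          (nhds (√(κ * r 0 / 2 / r 0 * (1 + 1)))) :=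
        ((A.div_const _).mul (Rho.const_add 1)).sqrt
      have : κ * r 0 / 2 / r 0 * (1 + 1) = κ := by field_simp; norm_num
      rw [this] at B1
      refine B1.congr' ?_
      filter_upwards [self_mem_nhdsWithin] with t ht
      have ht' : 0 < t := ht
      have : (r 0 - r t) / t ^ 2 / r 0 * (1 + ρ t) = (1 - ρ t ^ 2) / t ^ 2 := by
        simp only [hρ]; field_simp; ring
      rw [this, Real.sqrt_div' _ (by positivity), Real.sqrt_sq ht'.le]
    set q : ℝ → ℝ := fun t => √(1 - ρ t ^ 2) / ρ t with hq
    have C : Filter.Tendsto (fun t => q t / t) (nhdsWithin 0 (Set.Ioi 0)) (nhds (√κ)) := by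
      have := B.div Rho one_ne_zero
      rw [div_one] at this
      refine this.congr fun t => ?_
      simp only [hq, Pi.div_apply]
      rw [div_right_comm]
    have Q : Filter.Tendsto q (nhdsWithin 0 (Set.Ioi 0)) (nhds 0) := by
      have := ((Rho.pow 2).const_sub 1).sqrt.div Rho one_ne_zero
      norm_num at this
      exact this
    have D : Filter.Tendsto (fun t => dslope Real.arctan 0 (q t)) (nhdsWithin 0 (Set.Ioi 0)) (nhds 1) := by
      have h1 : ContinuousAt (dslope Real.arctan 0) 0 :=
        continuousAt_dslope_same.2 (Real.differentiable_arctan 0)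
      have h2 : dslope Real.arctan 0 0 = 1 := by simp [dslope_same]
      have h3 := h1.tendsto
      rw [h2] at h3
      exact h3.comp Q
    have E := ((C.mul D).comp hlim).const_mul (ℓ / Real.pi)
    rw [mul_one] at E
    refine E.congr' ?_
    filter_upwards [Filter.eventually_gt_atTop 0] with k hk
    have hk' : (0 : ℝ) < k := by exact_mod_cast hk
    have h4 : Real.arctan (q (ℓ / k)) = q (ℓ / k) * dslope Real.arctan 0 (q (ℓ / k)) := by
      have := sub_smul_dslope Real.arctan 0 (q (ℓ / k))
      simpa using this.symm
    change _ = (k : ℝ) * (Real.arctan (q (ℓ / k)) / Real.pi)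
    rw [h4]
    simp only [Function.comp]
    field_simp

lemma geom_deriv (n : ℕ) (Γ : (Fin n → ℝ) → ℝ) (hΓ : ContDiff ℝ 2 Γ) (v : Fin n → ℝ) :
    deriv (deriv (fun t : ℝ => Γ (t • v))) 0 = fderiv ℝ (fun y => fderiv ℝ Γ y v) 0 v := by
  have hd : Differentiable ℝ Γ := hΓ.differentiable (by norm_num)
  have hline : ∀ t : ℝ, HasDerivAt (fun t : ℝ => t • v) v t := fun t => by
    simpa using (hasDerivAt_id t).smul_const v
  have h1 : deriv (fun t : ℝ => Γ (t • v)) = fun t => fderiv ℝ Γ (t • v) v := by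
    ext t
    exact ((hd (t • v)).hasFDerivAt.comp_hasDerivAt t (hline t)).deriv
  rw [h1]
  have hd2 : Differentiable ℝ (fun y => fderiv ℝ Γ y v) := by
    have : ContDiff ℝ 1 (fderiv ℝ Γ) := hΓ.fderiv_right (by norm_num [one_add_one_eq_two])
    exact (this.differentiable (by norm_num)).clm_apply (differentiable_const v)
  have h2 := (hd2 ((0:ℝ) • v)).hasFDerivAt.comp_hasDerivAt 0 (hline 0)
  have h3 := h2.deriv
  rw [zero_smul] at h3
  exact h3

lemma aux_null {Ω : Type*} [MeasurableSpace Ω] (P : Measure Ω)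
    (f : ℝ → Ω → ℝ) (hm : ∀ t, Measurable (f t)) (σ2 : ℝ≥0) (h : σ2 ≠ 0)
    (hlaw : ∀ t, P.map (f t) = gaussianReal 0 σ2) (ℓ M : ℝ) :
    P {ω | ∀ k : ℕ, 0 < k → ∃ j ∈ Finset.range (k + 1), |f (j * (ℓ / k)) ω| ≤ M * (ℓ / k) ^ 2} = 0 := by
  set C := (√(2 * Real.pi * σ2))⁻¹ with hC
  have key : ∀ k : ℕ, 0 < k →
      P {ω | ∀ k : ℕ, 0 < k → ∃ j ∈ Finset.range (k + 1), |f (j * (ℓ / k)) ω| ≤ M * (ℓ / k) ^ 2} ≤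
        ENNReal.ofReal ((C * 2 * M * ℓ ^ 2) * ((1 + 1 / (k : ℝ)) * (1 / (k : ℝ)))) := by
    intro k hk
    have hk' : (0 : ℝ) < k := by exact_mod_cast hk
    calc _ ≤ P (⋃ j ∈ Finset.range (k + 1), f (j * (ℓ / k)) ⁻¹' Set.Icc (-(M * (ℓ / k) ^ 2)) (M * (ℓ / k) ^ 2)) := by
          refine measure_mono fun ω hω => ?_
          obtain ⟨j, hj, hle⟩ := hω k hk
          simp only [Set.mem_iUnion]
          exact ⟨j, hj, abs_le.1 hle⟩
      _ ≤ ∑ j ∈ Finset.range (k + 1), P (f (j * (ℓ / k)) ⁻¹' Set.Icc (-(M * (ℓ / k) ^ 2)) (M * (ℓ / k) ^ 2)) :=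
          measure_biUnion_finset_le _ _
      _ ≤ ∑ j ∈ Finset.range (k + 1), ENNReal.ofReal (C * (2 * (M * (ℓ / k) ^ 2))) := by
          refine Finset.sum_le_sum fun j _ => ?_
          rw [← Measure.map_apply (hm _) measurableSet_Icc, hlaw]
          exact aux_small σ2 h _
      _ = _ := by
          rw [Finset.sum_const, Finset.card_range, nsmul_eq_mul, ← ENNReal.ofReal_natCast,
            ← ENNReal.ofReal_mul (by positivity)]
          congr 1
          push_cast
          field_simp
  have lim : Filter.Tendsto (fun k : ℕ => ENNReal.ofReal ((C * 2 * M * ℓ ^ 2) * ((1 + 1 / (k : ℝ)) * (1 / (k : ℝ)))))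
      Filter.atTop (nhds 0) := by
    have l0 : Filter.Tendsto (fun k : ℕ => 1 / (k : ℝ)) Filter.atTop (nhds 0) :=
      tendsto_const_div_atTop_nhds_zero_nat 1
    have l1 := ENNReal.tendsto_ofReal (((l0.const_add 1).mul l0).const_mul (C * 2 * M * ℓ ^ 2))
    simpa using l1
  refine le_antisymm (ge_of_tendsto lim ?_) bot_le
  filter_upwards [Filter.eventually_gt_atTop 0] with k hk using key k hk

/-- **Proposition 4.1 (typical spacing), specialized to `X = ℝⁿ`.** Let `Φ` be a centered
Gaussian random field on `ℝⁿ` with a.s. smooth samples, invariant in distribution under all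
rigid motions, whose covariance function `Γ(x) = E[Φ(x)Φ(0)]` satisfies `ΔΓ = -μ Γ` with
`μ > 0` and `Γ(0) > 0`.  Then along any unit direction `γ`, the expected number of zeros of
`t ↦ Φ(tγ)` on `[0, ℓ]` equals `(ℓ/π) √(μ/n)`; equivalently the typical spacing of `Φ` is
`π √(n/μ)`. -/
theorem typical_spacing_of_invariant_laplace_eigenfield
    (n : ℕ) (hn : 1 ≤ n)
    {Ω : Type*} [MeasurableSpace Ω] (P : Measure Ω) [IsProbabilityMeasure P]
    (Φ : (Fin n → ℝ) → Ω → ℝ)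
    (hmeas : ∀ x, Measurable (Φ x))
    -- Gaussian field: every finite real linear combination is a (possibly degenerate) Gaussian
    (hgauss : ∀ (m : ℕ) (x : Fin m → (Fin n → ℝ)) (a : Fin m → ℝ),
      ∃ (c : ℝ) (v : ℝ≥0),
        Measure.map (fun ω => ∑ i, a i * Φ (x i) ω) P = gaussianReal c v)
    -- centered
    (hcentered : ∀ x, ∫ ω, Φ x ω ∂P = 0)
    -- almost surely smooth sample paths
    (hpaths : ∀ᵐ ω ∂P, ContDiff ℝ (⊤ : ℕ∞) fun x => Φ x ω)
    -- invariance of the finite-dimensional distributions under all rigid motions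
    (hinv : ∀ (g : Matrix (Fin n) (Fin n) ℝ), g * gᵀ = 1 → ∀ (b : Fin n → ℝ)
      (m : ℕ) (x : Fin m → (Fin n → ℝ)),
        Measure.map (fun ω (i : Fin m) => Φ (g.mulVec (x i) + b) ω) P =
          Measure.map (fun ω (i : Fin m) => Φ (x i) ω) P)
    -- the covariance function, a Laplace eigenfunction with eigenvalue `-μ`
    (Γ : (Fin n → ℝ) → ℝ) (hΓ : Γ = fun x => ∫ ω, Φ x ω * Φ 0 ω ∂P)
    (hΓC2 : ContDiff ℝ 2 Γ)
    (μ : ℝ) (hμpos : 0 < μ)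
    (heigen : ∀ x, ∑ i : Fin n,
        fderiv ℝ (fun y => fderiv ℝ Γ y (Pi.single i 1)) x (Pi.single i 1) = -μ * Γ x)
    (hΓ0 : 0 < Γ 0)
    (γ : Fin n → ℝ) (hγ : ∑ i, γ i ^ 2 = 1) (ℓ : ℝ) (hℓ : 0 < ℓ) :
    ∫⁻ ω, ({t : ℝ | t ∈ Set.Icc 0 ℓ ∧ Φ (t • γ) ω = 0}.encard : ℝ≥0∞) ∂P =
      ENNReal.ofReal ((ℓ / Real.pi) * Real.sqrt (μ / n)) := by
  classical
  have hG : ∀ x y, HasGaussianLaw (fun ω => (Φ x ω, Φ y ω)) P := by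
    intro x y
    refine aux_hasGauss P _ _ (hmeas x) (hmeas y) fun a b => ?_
    obtain ⟨c, v, hcv⟩ := hgauss 2 ![x, y] ![a, b]
    refine ⟨c, v, ?_⟩
    rw [← hcv]
    simp [Fin.sum_univ_two]
  have hpair : ∀ (g : Matrix (Fin n) (Fin n) ℝ), g * gᵀ = 1 → ∀ b x y : Fin n → ℝ,
      ∫ ω, Φ (g.mulVec x + b) ω * Φ (g.mulVec y + b) ω ∂P = ∫ ω, Φ x ω * Φ y ω ∂P := by
    intro g hg b x y
    have h := hinv g hg b 2 ![x, y]
    have hF : Measurable (fun p : Fin 2 → ℝ => p 0 * p 1) := by fun_prop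
    have h2 := congrArg (fun m => ∫ p : Fin 2 → ℝ, p 0 * p 1 ∂m) h
    rw [integral_map (by exact (measurable_pi_lambda _ fun i => hmeas _).aemeasurable) hF.aestronglyMeasurable,
      integral_map (by exact (measurable_pi_lambda _ fun i => hmeas _).aemeasurable) hF.aestronglyMeasurable] at h2
    simpa using h2
  have hΓx : ∀ x, Γ x = ∫ ω, Φ x ω * Φ 0 ω ∂P := fun x => by rw [hΓ]
  have hstat : ∀ x b : Fin n → ℝ, ∫ ω, Φ (x + b) ω * Φ b ω ∂P = Γ x := by
    intro x b
    have := hpair 1 (by simp) b x 0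
    simpa [hΓx] using this
  have hself : ∀ x : Fin n → ℝ, ∫ ω, Φ x ω * Φ x ω ∂P = Γ 0 := by
    intro x; simpa using hstat 0 x
  have hrot : ∀ (g : Matrix (Fin n) (Fin n) ℝ), g * gᵀ = 1 → ∀ x, Γ (g.mulVec x) = Γ x := by
    intro g hg x
    have := hpair g hg 0 x 0
    simpa [hΓx] using this
  set σ2 : ℝ≥0 := (Γ 0).toNNReal with hσ2
  have hσ0 : σ2 ≠ 0 := by rw [hσ2]; simpa using hΓ0
  have hlaw : ∀ x, P.map (Φ x) = gaussianReal 0 σ2 := by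
    intro x
    rw [(hG x x).fst.map_eq_gaussianReal, hcentered,
      variance_of_integral_eq_zero (hmeas x).aemeasurable (hcentered x)]
    have : ∫ ω, Φ x ω ^ 2 ∂P = Γ 0 := by rw [← hself x]; simp [sq]
    rw [this]
  -- the covariance along the line
  set r : ℝ → ℝ := fun t => Γ (t • γ) with hr
  have hrC : ContDiff ℝ 2 r := hΓC2.comp (contDiff_id.smul contDiff_const)
  have hr0 : r 0 = Γ 0 := by simp [hr]
  have heven : ∀ t, r (-t) = r t := by
    intro t
    have := hrot (-1) (by simp) (t • γ)
    simpa [hr, neg_mulVec] using this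
  have hreq : ∀ i : Fin n, (fun t : ℝ => Γ (t • (Pi.single i 1 : Fin n → ℝ))) = r := by
    intro i
    obtain ⟨g, hg, hgi⟩ := geom_rot n γ hγ i
    ext t
    rw [← hrot g hg, mulVec_smul, hgi]
  have hn0 : (0 : ℝ) < n := by exact_mod_cast hn
  have hdd : deriv (deriv r) 0 = -(μ / n) * r 0 := by
    have h1 := heigen 0
    have h2 : ∀ i : Fin n, fderiv ℝ (fun y => fderiv ℝ Γ y (Pi.single i 1)) 0 (Pi.single i 1) = deriv (deriv r) 0 := by
      intro i
      rw [← geom_deriv n Γ hΓC2, hreq i]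
    simp_rw [h2] at h1
    rw [Finset.sum_const, Finset.card_univ, Fintype.card_fin, nsmul_eq_mul, ← hr0] at h1
    field_simp
    linarith
  obtain ⟨hev, hlim⟩ := asym_main r hrC heven (μ / n) (by positivity) (by rw [hr0]; exact hΓ0) hdd ℓ hℓ
  set N : ℕ → Ω → ℝ≥0∞ := fun k ω => ∑ j ∈ Finset.range k,
    if Φ (((j : ℝ) * (ℓ / k)) • γ) ω * Φ ((((j + 1 : ℕ) : ℝ) * (ℓ / k)) • γ) ω < 0 then (1 : ℝ≥0∞) else 0 with hN
  have hset : ∀ x y, MeasurableSet {ω | Φ x ω * Φ y ω < 0} := fun x y =>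
    measurableSet_lt ((hmeas x).mul (hmeas y)) measurable_const
  have hNm : ∀ k, Measurable (N k) := by
    intro k
    refine Finset.measurable_sum _ fun j _ => ?_
    exact Measurable.ite (hset _ _) measurable_const measurable_const
  have hEN : ∀ᶠ k : ℕ in Filter.atTop, ∫⁻ ω, N k ω ∂P =
      ENNReal.ofReal ((k : ℝ) * (Real.arctan (√(1 - (r (ℓ / k) / r 0) ^ 2) / (r (ℓ / k) / r 0)) / Real.pi)) := by
    filter_upwards [hev] with k hk
    have hp : ∀ j : ℕ, P {ω | Φ (((j : ℝ) * (ℓ / k)) • γ) ω * Φ ((((j + 1 : ℕ) : ℝ) * (ℓ / k)) • γ) ω < 0} =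
        ENNReal.ofReal (Real.arctan (√(1 - (r (ℓ / k) / r 0) ^ 2) / (r (ℓ / k) / r 0)) / Real.pi) := by
      intro j
      refine aux_pair P _ _ (hmeas _) (hmeas _) (hG _ _) (hcentered _) (hcentered _) (Γ 0) _ hΓ0
        (hself _) (hself _) ?_ hk.1 hk.2
      have e : (((j + 1 : ℕ) : ℝ) * (ℓ / k)) • γ = (ℓ / k) • γ + ((j : ℝ) * (ℓ / k)) • γ := by
        rw [← add_smul]; push_cast; congr 1; ring
      rw [e, hstat, ← hr0]
      change r (ℓ / k) = _
      rw [div_mul_cancel₀]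
      rw [hr0]; exact hΓ0.ne'
    simp only [hN]
    rw [lintegral_finsetSum _ (fun j _ => Measurable.ite (hset _ _) measurable_const measurable_const)]
    have e2 : ∀ j : ℕ, ∫⁻ ω, (if Φ (((j : ℝ) * (ℓ / k)) • γ) ω * Φ ((((j + 1 : ℕ) : ℝ) * (ℓ / k)) • γ) ω < 0
        then (1 : ℝ≥0∞) else 0) ∂P =
        ENNReal.ofReal (Real.arctan (√(1 - (r (ℓ / k) / r 0) ^ 2) / (r (ℓ / k) / r 0)) / Real.pi) := by
      intro j
      rw [← hp j, ← lintegral_indicator_one (hset _ _)]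
      refine lintegral_congr fun ω => ?_
      simp [Set.indicator_apply]
    simp_rw [e2]
    rw [Finset.sum_const, Finset.card_range, nsmul_eq_mul, ENNReal.ofReal_mul (by positivity),
      ENNReal.ofReal_natCast]
  have hENlim : Filter.Tendsto (fun k => ∫⁻ ω, N k ω ∂P) Filter.atTop
      (nhds (ENNReal.ofReal ((ℓ / Real.pi) * Real.sqrt (μ / n)))) := by
    refine (ENNReal.tendsto_ofReal hlim).congr' ?_
    filter_upwards [hEN] with k hk using hk.symm
  -- almost sure regularity
  have hgood1 : ∀ᵐ ω ∂P, ∀ k j : ℕ, Φ (((j : ℝ) * (ℓ / k)) • γ) ω ≠ 0 := by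
    rw [ae_all_iff]; intro k
    rw [ae_all_iff]; intro j
    rw [ae_iff]
    have : {ω | ¬ Φ (((j : ℝ) * (ℓ / k)) • γ) ω ≠ 0} = Φ (((j : ℝ) * (ℓ / k)) • γ) ⁻¹' {0} := by
      ext ω; simp
    rw [this, ← Measure.map_apply (hmeas _) (measurableSet_singleton 0), hlaw]
    have := nullSingletonClass_gaussianReal (μ := 0) hσ0
    exact measure_singleton 0
  have hgood2 : ∀ᵐ ω ∂P, ∀ M : ℕ, ¬ ∀ k : ℕ, 0 < k → ∃ j ∈ Finset.range (k + 1),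
      |Φ (((j : ℝ) * (ℓ / k)) • γ) ω| ≤ M * (ℓ / k) ^ 2 := by
    rw [ae_all_iff]; intro M
    rw [ae_iff]
    simp only [not_not]
    exact aux_null P (fun t => Φ (t • γ)) (fun t => hmeas _) σ2 hσ0 (fun t => hlaw _) ℓ M
  have hpath1 : ∀ᵐ ω ∂P, ContDiff ℝ 2 (fun t : ℝ => Φ (t • γ) ω) := by
    filter_upwards [hpaths] with ω hω
    have h2 : ContDiff ℝ 2 (fun x => Φ x ω) := contDiff_infty.1 hω 2
    exact h2.comp (contDiff_id.smul contDiff_const)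
  have htr : ∀ᵐ ω ∂P, ∀ z ∈ Set.Icc 0 ℓ, Φ (z • γ) ω = 0 → deriv (fun t : ℝ => Φ (t • γ) ω) z ≠ 0 := by
    filter_upwards [hpath1, hgood2] with ω hC hB z hz hz0 hd
    have hcont : Continuous (deriv (deriv (fun t : ℝ => Φ (t • γ) ω))) := by
      have := hC.continuous_iteratedDeriv 2 le_rfl
      rwa [iteratedDeriv_succ, iteratedDeriv_one] at this
    obtain ⟨C, hCb⟩ := isCompact_Icc.exists_bound_of_continuousOn (s := Set.Icc 0 ℓ) hcont.continuousOn
    obtain ⟨M, hM⟩ := exists_nat_ge C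
    refine hB M fun k hk => ?_
    exact det_tang (fun t : ℝ => Φ (t • γ) ω) hC ℓ hℓ M (fun x hx => (hCb x hx).trans hM) z hz hz0 hd k hk
  apply le_antisymm
  · calc _ ≤ ∫⁻ ω, Filter.liminf (fun k => N k ω) Filter.atTop ∂P := by
          refine lintegral_mono_ae ?_
          filter_upwards [hpath1, hgood1, htr] with ω h1 h2 h3
          exact det_ge (fun t : ℝ => Φ (t • γ) ω) (h1.differentiable (by norm_num)) ℓ hℓ h2 h3
      _ ≤ Filter.liminf (fun k => ∫⁻ ω, N k ω ∂P) Filter.atTop := lintegral_liminf_le hNm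
      _ = _ := hENlim.liminf_eq
  · refine le_of_tendsto hENlim ?_
    filter_upwards [Filter.eventually_gt_atTop 0] with k hk
    have hk' : (0 : ℝ) < k := by exact_mod_cast hk
    refine lintegral_mono_ae ?_
    filter_upwards [hpath1] with ω h1
    exact det_le (fun t : ℝ => Φ (t • γ) ω) h1.continuous ℓ (ℓ / k) (by positivity) k (by
      rw [mul_div_cancel₀]; exact hk'.ne')
end
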